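/- Let 1/2 < s < 1, let f : ℝ → ℂ be a Schwartz function, and let ξ₁ ≤ ξ₂ be real numbers with ξ₂ − ξ₁ ≤ 1. Then there is a constant C(s) > 0 depending only on s such that |∫_ℝ E₂(ξ; ξ₁, ξ₂) f′(ξ) dξ| ≤ C(s) ‖f‖_{H^s(ℝ)} (ξ₂ − ξ₁)^{s−1/2}. -/

import Mathlib

open MeasureTheory

/-- The Fourier transform `𝓕(f)(k) = (1/(2π)) ∫_ℝ e^{-ikξ} f(ξ) dξ`. -/
noncomputable def FT (f : ℝ → ℂ) (k : ℝ) : ℂ :=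
  (1 / (2 * Real.pi)) * ∫ ξ : ℝ, Complex.exp (-Complex.I * k * ξ) * f ξ

/-- The fractional Sobolev norm `‖f‖_{H^s} = (2π ∫_ℝ (1+|k|²)^s |𝓕(f)(k)|² dk)^{1/2}`. -/
noncomputable def HsNorm (s : ℝ) (f : ℝ → ℂ) : ℝ :=
  Real.sqrt (2 * Real.pi * ∫ k : ℝ, (1 + |k| ^ 2) ^ s * ‖FT f k‖ ^ 2)

/-- `E₂(ξ; ξ₁, ξ₂) = e^{ξ-ξ₂}` for `ξ₁ ≤ ξ ≤ ξ₂`, and `0` otherwise. -/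
noncomputable def E2 (ξ₁ ξ₂ ξ : ℝ) : ℝ :=
  if ξ₁ ≤ ξ ∧ ξ ≤ ξ₂ then Real.exp (ξ - ξ₂) else 0

open scoped FourierTransform

/-- Kernel after rescaling. -/
noncomputable def kerP (s u : ℝ) : ℝ := |u| ^ (-s) * min 1 |u|

lemma kerP_nonneg (s u : ℝ) : 0 ≤ kerP s u := by
  unfold kerP; positivity

lemma kerP_meas (s : ℝ) : Measurable (kerP s) := by
  unfold kerP; fun_prop

lemma kerP_sq_le (s : ℝ) (hs₁ : 1 / 2 < s) (hs₂ : s < 1) (u : ℝ) :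
    kerP s u ^ 2 ≤ 2 ^ s * (1 + ‖u‖ ^ 2) ^ (-(2 * s) / 2) := by
  have e : -(2 * s) / 2 = -s := by ring
  rw [e, Real.norm_eq_abs]
  have h0 : 0 < 1 + |u| ^ 2 := by positivity
  have key : (2 : ℝ) ^ s * (1 + |u| ^ 2) ^ (-s) = ((1 + |u| ^ 2) / 2) ^ (-s) := by
    rw [Real.div_rpow h0.le (by norm_num), Real.rpow_neg (by norm_num : (0 : ℝ) ≤ 2)]
    field_simp
  rw [key]
  rcases le_total |u| 1 with h | h
  · have h1 : kerP s u ≤ 1 := by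
      unfold kerP
      rw [min_eq_right h]
      rcases eq_or_lt_of_le (abs_nonneg u) with h' | h'
      · rw [← h']; simp
      · nth_rewrite 2 [← Real.rpow_one |u|]
        rw [← Real.rpow_add h']
        exact Real.rpow_le_one h'.le h (by linarith)
    have h2 : kerP s u ^ 2 ≤ 1 := pow_le_one₀ (kerP_nonneg s u) h1
    refine h2.trans ?_
    apply Real.one_le_rpow_of_pos_of_le_one_of_nonpos (by positivity)
    · nlinarith [abs_nonneg u]
    · linarith
  · unfold kerP
    rw [min_eq_left h, mul_one, ← Real.rpow_natCast, ← Real.rpow_mul (abs_nonneg u), mul_comm,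
      Real.rpow_mul (abs_nonneg u), Real.rpow_natCast]
    apply Real.rpow_le_rpow_of_nonpos (by positivity)
    · nlinarith
    · linarith

lemma kerP_int (s : ℝ) (hs₁ : 1 / 2 < s) (hs₂ : s < 1) :
    Integrable (fun u => kerP s u ^ 2) := by
  have h := (integrable_rpow_neg_one_add_norm_sq (E := ℝ) (μ := volume) (r := 2 * s)
    (by simp; linarith)).const_mul (2 ^ s)
  refine h.mono' ((kerP_meas s).pow_const 2).aestronglyMeasurable (ae_of_all _ fun u => ?_)
  rw [Real.norm_of_nonneg (by positivity)]
  exact kerP_sq_le s hs₁ hs₂ u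

/-- Weighted transform. -/
noncomputable def wtQ (s : ℝ) (F : SchwartzMap ℝ ℂ) (k : ℝ) : ℝ :=
  (1 + |2 * Real.pi * k| ^ 2) ^ (s / 2) * ‖F k‖

lemma wtQ_sq (s : ℝ) (F : SchwartzMap ℝ ℂ) (k : ℝ) :
    wtQ s F k ^ 2 = (1 + |2 * Real.pi * k| ^ 2) ^ s * ‖F k‖ ^ 2 := by
  unfold wtQ
  rw [mul_pow, ← Real.rpow_natCast (_ ^ (s / 2)), ← Real.rpow_mul (by positivity)]
  congr 2
  push_cast; ring

lemma wtQ_cont (s : ℝ) (F : SchwartzMap ℝ ℂ) : Continuous (wtQ s F) := by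
  unfold wtQ
  refine Continuous.mul (Continuous.rpow_const (by fun_prop) fun x => Or.inl (by positivity)) ?_
  exact F.continuous.norm

lemma wtQ_int (s : ℝ) (hs₂ : s < 1) (F : SchwartzMap ℝ ℂ) :
    Integrable (fun u => wtQ s F u ^ 2) := by
  obtain ⟨D, hD⟩ : ∃ D : ℝ, ∀ x : ℝ, (1 + ‖x‖) ^ 2 * ‖F x‖ ≤ D := by
    refine ⟨2 ^ 2 * ((Finset.Iic ((2, 0) : ℕ × ℕ)).sup
      fun m => SchwartzMap.seminorm ℝ m.1 m.2) F, fun x => ?_⟩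
    have := SchwartzMap.one_add_le_sup_seminorm_apply (𝕜 := ℝ) (m := (2, 0)) (k := 2) (n := 0)
      le_rfl le_rfl F x
    rw [norm_iteratedFDeriv_zero] at this
    exact this
  have h := (integrable_rpow_neg_one_add_norm_sq (E := ℝ) (μ := volume) (r := 2)
    (by simp)).const_mul ((2 * Real.pi) ^ 2 * D ^ 2)
  refine h.mono' ((wtQ_cont s F).pow 2).aestronglyMeasurable (ae_of_all _ fun u => ?_)
  rw [Real.norm_of_nonneg (by positivity), wtQ_sq]
  have e : -(2 : ℝ) / 2 = -1 := by norm_num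
  rw [e, Real.rpow_neg_one, ← div_eq_mul_inv, le_div_iff₀ (by positivity), Real.norm_eq_abs]
  have hDu := hD u
  rw [Real.norm_eq_abs] at hDu
  have hpi : 1 ≤ 2 * Real.pi := by linarith [Real.pi_gt_three]
  have hu := abs_nonneg u
  have h1 : (1 + |2 * Real.pi * u| ^ 2) ^ s ≤ (2 * Real.pi) ^ 2 * (1 + |u|) ^ 2 := by
    calc (1 + |2 * Real.pi * u| ^ 2) ^ s ≤ (1 + |2 * Real.pi * u| ^ 2) ^ (1 : ℝ) :=
          Real.rpow_le_rpow_of_exponent_le (by nlinarith [abs_nonneg (2 * Real.pi * u)]) hs₂.le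
      _ = 1 + (2 * Real.pi) ^ 2 * |u| ^ 2 := by
          rw [Real.rpow_one, abs_mul, abs_of_pos (by positivity : 0 < 2 * Real.pi)]; ring
      _ ≤ (2 * Real.pi) ^ 2 * (1 + |u| ^ 2) := by nlinarith
      _ ≤ _ := by gcongr; nlinarith
  have h2 : ((1 + |u|) ^ 2 * ‖F u‖) ^ 2 ≤ D ^ 2 := by gcongr
  calc _ ≤ (2 * Real.pi) ^ 2 * (1 + |u|) ^ 2 * ‖F u‖ ^ 2 * (1 + |u|) ^ 2 := by
        gcongr; nlinarith
    _ = (2 * Real.pi) ^ 2 * ((1 + |u|) ^ 2 * ‖F u‖) ^ 2 := by ring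
    _ ≤ _ := by gcongr

lemma FT_eq (f : SchwartzMap ℝ ℂ) (k : ℝ) :
    FT (fun x => f x) k = (1 / (2 * Real.pi)) * (𝓕 f) (k / (2 * Real.pi)) := by
  unfold FT
  rw [SchwartzMap.fourier_coe, Real.fourier_real_eq_integral_exp_smul]
  congr 1
  refine integral_congr_ae (ae_of_all _ fun x => ?_)
  simp only [smul_eq_mul]
  congr 2
  have : (Real.pi : ℂ) ≠ 0 := by exact_mod_cast Real.pi_ne_zero
  push_cast
  field_simp

lemma HsNorm_eq (s : ℝ) (f : SchwartzMap ℝ ℂ) :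
    HsNorm s (fun x => f x) = Real.sqrt (∫ k, wtQ s (𝓕 f) k ^ 2) := by
  unfold HsNorm
  congr 1
  have h := Measure.integral_comp_div (fun k => wtQ s (𝓕 f) k ^ 2) (2 * Real.pi)
  have hp : 0 < 2 * Real.pi := by positivity
  rw [abs_of_pos hp, smul_eq_mul] at h
  have h2 : ∀ k : ℝ, (1 + |k| ^ 2) ^ s * ‖FT (fun x => f x) k‖ ^ 2
      = (1 / (2 * Real.pi)) ^ 2 * wtQ s (𝓕 f) (k / (2 * Real.pi)) ^ 2 := by
    intro k
    rw [wtQ_sq, FT_eq, mul_div_cancel₀ _ hp.ne', norm_mul, mul_pow]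
    have : ‖(1 / (2 * Real.pi) : ℂ)‖ = 1 / (2 * Real.pi) := by
      have : (1 / (2 * Real.pi) : ℂ) = ((1 / (2 * Real.pi) : ℝ) : ℂ) := by push_cast; rfl
      rw [this, Complex.norm_real, Real.norm_of_nonneg (by positivity)]
    rw [this]; ring
  simp_rw [h2]
  rw [integral_const_mul, h]
  field_simp

lemma exp_diff (k x y : ℝ) :
    ‖Complex.exp (((2 * Real.pi * (k * x) : ℝ) : ℂ) * Complex.I)
      - Complex.exp (((2 * Real.pi * (k * y) : ℝ) : ℂ) * Complex.I)‖
      ≤ 2 * Real.pi * min 1 |(x - y) * k| := by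
  rw [mul_min_of_nonneg _ _ (by positivity)]
  refine le_min ?_ ?_
  · refine (norm_sub_le _ _).trans ?_
    rw [Complex.norm_exp_ofReal_mul_I, Complex.norm_exp_ofReal_mul_I]
    linarith [Real.pi_gt_three]
  · have e : Complex.exp (((2 * Real.pi * (k * x) : ℝ) : ℂ) * Complex.I)
      - Complex.exp (((2 * Real.pi * (k * y) : ℝ) : ℂ) * Complex.I)
      = Complex.exp (((2 * Real.pi * (k * y) : ℝ) : ℂ) * Complex.I) *
        (Complex.exp (Complex.I * ((2 * Real.pi * ((x - y) * k) : ℝ) : ℂ)) - 1) := by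
      rw [mul_sub, ← Complex.exp_add, mul_one]
      congr 2
      push_cast; ring
    rw [e, norm_mul, Complex.norm_exp_ofReal_mul_I, one_mul]
    refine Real.norm_exp_I_mul_ofReal_sub_one_le.trans ?_
    rw [Real.norm_eq_abs, abs_mul, abs_of_pos (by positivity : 0 < 2 * Real.pi)]

lemma holder (s : ℝ) (hs₁ : 1 / 2 < s) (hs₂ : s < 1) (f : SchwartzMap ℝ ℂ) (x y : ℝ)
    (hxy : y < x) :
    ‖f x - f y‖ ≤ 2 * Real.pi * Real.sqrt (∫ u, kerP s u ^ 2) * HsNorm s (fun x => f x)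
      * (x - y) ^ (s - 1 / 2) := by
  have hh : 0 < x - y := by linarith
  set h := x - y with hhdef
  set F := 𝓕 f with hF
  have inv : ∀ z, f z = ∫ k, Complex.exp (((2 * Real.pi * (k * z) : ℝ) : ℂ) * Complex.I) * F k := by
    intro z
    have h1 : f = 𝓕⁻ F := (FourierPair.fourierInv_fourier_eq f).symm
    conv_lhs => rw [h1]
    rw [SchwartzMap.fourierInv_coe, Real.fourierInv_eq']
    refine integral_congr_ae (ae_of_all _ fun k => ?_)
    simp [mul_comm]
  have intg : ∀ z : ℝ, Integrable
      (fun k : ℝ => Complex.exp (((2 * Real.pi * (k * z) : ℝ) : ℂ) * Complex.I) * F k) := by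
    intro z
    refine F.integrable.norm.mono' (Continuous.aestronglyMeasurable ?_) (ae_of_all _ fun k => ?_)
    · exact Continuous.mul (by fun_prop) F.continuous
    · rw [norm_mul, Complex.norm_exp_ofReal_mul_I, one_mul]
  set p : ℝ → ℝ := fun k => h ^ s * kerP s (h * k) with hp
  have psq : ∀ k, p k ^ 2 = h ^ (2 * s) * kerP s (h * k) ^ 2 := by
    intro k
    rw [hp]
    simp only
    rw [mul_pow, ← Real.rpow_natCast, ← Real.rpow_mul hh.le]
    congr 2
    push_cast; ring
  have pint : Integrable (fun k => p k ^ 2) := by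
    simp_rw [psq]
    exact ((kerP_int s hs₁ hs₂).comp_mul_left' hh.ne').const_mul _
  have pval : ∫ k, p k ^ 2 = h ^ (2 * s - 1) * ∫ u, kerP s u ^ 2 := by
    simp_rw [psq]
    rw [integral_const_mul, Measure.integral_comp_mul_left (fun u => kerP s u ^ 2),
      abs_of_pos (by positivity), smul_eq_mul, Real.rpow_sub_one hh.ne']
    ring
  have p0 : ∀ k, 0 ≤ p k := fun k => mul_nonneg (by positivity) (kerP_nonneg _ _)
  have q0 : ∀ k, 0 ≤ wtQ s F k := fun k => by unfold wtQ; positivity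
  have pm : MemLp p 2 := (memLp_two_iff_integrable_sq
    (((kerP_meas s).comp (measurable_const_mul h)).const_mul _).aestronglyMeasurable).2 pint
  have qm : MemLp (wtQ s F) 2 := (memLp_two_iff_integrable_sq
    (wtQ_cont s F).aestronglyMeasurable).2 (wtQ_int s hs₂ F)
  have cs : ∫ k, p k * wtQ s F k ≤ Real.sqrt (∫ k, p k ^ 2) * Real.sqrt (∫ k, wtQ s F k ^ 2) := by
    have := integral_mul_le_Lp_mul_Lq_of_nonneg (μ := volume) Real.HolderConjugate.two_two
      (ae_of_all _ p0) (ae_of_all _ q0) (by simpa using pm) (by simpa using qm)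
    simpa [Real.sqrt_eq_rpow] using this
  have pqint : Integrable (fun k => p k * wtQ s F k) := pm.integrable_mul qm
  have ptw : ∀ k, min 1 |h * k| * ‖F k‖ ≤ p k * wtQ s F k := by
    intro k
    rcases eq_or_ne k 0 with rfl | hk
    · simpa using mul_nonneg (p0 0) (q0 0)
    have hk' : 0 < |k| := abs_pos.2 hk
    have e : p k = |k| ^ (-s) * min 1 |h * k| := by
      simp only [hp, kerP]
      rw [abs_mul, abs_of_pos hh, Real.mul_rpow hh.le hk'.le, Real.rpow_neg hh.le]
      field_simp
    have hw : 1 ≤ |k| ^ (-s) * (1 + |2 * Real.pi * k| ^ 2) ^ (s / 2) := by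
      rw [Real.rpow_neg hk'.le, ← div_eq_inv_mul, le_div_iff₀ (by positivity), one_mul]
      have e1 : |k| ^ s = (|k| ^ 2) ^ (s / 2) := by
        rw [← Real.rpow_natCast, ← Real.rpow_mul hk'.le]; congr 1; push_cast; ring
      rw [e1]
      apply Real.rpow_le_rpow (by positivity) _ (by linarith)
      rw [abs_mul, abs_of_pos (by positivity : 0 < 2 * Real.pi)]
      have : 1 ≤ 2 * Real.pi := by linarith [Real.pi_gt_three]
      nlinarith [mul_le_mul_of_nonneg_right this hk'.le]
    rw [e]
    unfold wtQ
    calc _ = 1 * (min 1 |h * k| * ‖F k‖) := by ring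
      _ ≤ (|k| ^ (-s) * (1 + |2 * Real.pi * k| ^ 2) ^ (s / 2)) * (min 1 |h * k| * ‖F k‖) := by
        gcongr
      _ = _ := by ring
  rw [inv x, inv y, ← integral_sub (intg x) (intg y)]
  have b1 : ‖∫ k, (Complex.exp (((2 * Real.pi * (k * x) : ℝ) : ℂ) * Complex.I) * F k
      - Complex.exp (((2 * Real.pi * (k * y) : ℝ) : ℂ) * Complex.I) * F k)‖
      ≤ ∫ k, 2 * Real.pi * (p k * wtQ s F k) := by
    refine norm_integral_le_of_norm_le (pqint.const_mul _) (ae_of_all _ fun k => ?_)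
    rw [← sub_mul, norm_mul]
    calc _ ≤ 2 * Real.pi * min 1 |h * k| * ‖F k‖ := by gcongr; exact exp_diff k x y
      _ = 2 * Real.pi * (min 1 |h * k| * ‖F k‖) := by ring
      _ ≤ _ := mul_le_mul_of_nonneg_left (ptw k) (by positivity)
  refine b1.trans ?_
  rw [integral_const_mul, HsNorm_eq, ← hF]
  have e3 : Real.sqrt (∫ k, p k ^ 2) = h ^ (s - 1 / 2) * Real.sqrt (∫ u, kerP s u ^ 2) := by
    rw [pval, Real.sqrt_mul (by positivity)]
    congr 1
    rw [Real.sqrt_eq_rpow, ← Real.rpow_mul hh.le]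
    congr 1; ring
  rw [e3] at cs
  calc _ ≤ 2 * Real.pi * _ := mul_le_mul_of_nonneg_left cs (by positivity)
    _ = _ := by ring

/-- For `1/2 < s < 1`, a Schwartz function `f` and `ξ₁ ≤ ξ₂` with `ξ₂ - ξ₁ ≤ 1`:
`|∫_ℝ E₂(ξ; ξ₁, ξ₂) f'(ξ) dξ| ≤ C(s) ‖f‖_{H^s} (ξ₂ - ξ₁)^{s-1/2}`. -/
theorem I2_bound (s : ℝ) (hs₁ : 1 / 2 < s) (hs₂ : s < 1) :
    ∃ C : ℝ, 0 < C ∧ ∀ f : SchwartzMap ℝ ℂ, ∀ ξ₁ ξ₂ : ℝ, ξ₁ ≤ ξ₂ → ξ₂ - ξ₁ ≤ 1 →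
      ‖∫ ξ : ℝ, (E2 ξ₁ ξ₂ ξ : ℂ) * deriv (fun x : ℝ => f x) ξ‖ ≤
        C * HsNorm s (fun x => f x) * (ξ₂ - ξ₁) ^ (s - 1 / 2) := by
  set K := 2 * Real.pi * Real.sqrt (∫ u, kerP s u ^ 2) with hK
  have hK0 : 0 ≤ K := by positivity
  refine ⟨2 * K + 1, by positivity, fun f a b hab hab1 => ?_⟩
  have hN : 0 ≤ HsNorm s (fun x => f x) := Real.sqrt_nonneg _
  set N := HsNorm s (fun x => f x) with hNdef
  have hB : ∀ x ∈ Set.Icc a b, ‖f x - f a‖ ≤ K * N * (b - a) ^ (s - 1 / 2) := by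
    intro x hx
    rcases eq_or_lt_of_le hx.1 with rfl | h
    · simp only [sub_self, norm_zero]
      have : 0 ≤ b - a := by linarith
      positivity
    · refine (holder s hs₁ hs₂ f x a h).trans ?_
      gcongr
      · exact hx.2
  have e1 : ∫ ξ : ℝ, (E2 a b ξ : ℂ) * deriv (fun x : ℝ => f x) ξ
      = ∫ ξ in a..b, (Real.exp (ξ - b) : ℂ) * deriv (fun x : ℝ => f x) ξ := by
    rw [intervalIntegral.integral_of_le hab, ← integral_Icc_eq_integral_Ioc,
      ← integral_indicator measurableSet_Icc]
    congr 1
    ext ξ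
    by_cases h : a ≤ ξ ∧ ξ ≤ b
    · rw [Set.indicator_of_mem (show ξ ∈ Set.Icc a b from h)]; simp [E2, h]
    · rw [Set.indicator_of_notMem (show ξ ∉ Set.Icc a b from h)]; simp [E2, h]
  have hd : ∀ x : ℝ, HasDerivAt (fun x : ℝ => f x - f a) (deriv (fun x : ℝ => f x) x) x :=
    fun x => (f.differentiableAt.hasDerivAt).sub_const _
  have hu : ∀ x : ℝ, HasDerivAt (fun x : ℝ => (Real.exp (x - b) : ℂ)) (Real.exp (x - b) : ℂ) x := by
    intro x
    have := (((hasDerivAt_id x).sub_const b).exp).ofReal_comp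
    simpa using this
  have hcu : Continuous (fun x : ℝ => (Real.exp (x - b) : ℂ)) := by fun_prop
  have hcd : Continuous (deriv (fun x : ℝ => f x)) :=
    (f.smooth 1).continuous_deriv le_rfl
  have ibp := intervalIntegral.integral_mul_deriv_eq_deriv_mul (a := a) (b := b)
    (fun x _ => hu x) (fun x _ => hd x) (hcu.intervalIntegrable _ _) (hcd.intervalIntegrable _ _)
  rw [e1, ibp]
  set B := K * N * (b - a) ^ (s - 1 / 2) with hBdef
  have hB0 : 0 ≤ B := (norm_nonneg _).trans (hB a ⟨le_rfl, hab⟩)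
  have i1 : ‖∫ x in a..b, (Real.exp (x - b) : ℂ) * (f x - f a)‖ ≤ B * |b - a| := by
    apply intervalIntegral.norm_integral_le_of_norm_le_const
    intro x hx
    rw [Set.uIoc_of_le hab] at hx
    rw [norm_mul, Complex.norm_real, Real.norm_of_nonneg (Real.exp_pos _).le]
    calc _ ≤ 1 * B := mul_le_mul (Real.exp_le_one_iff.2 (by linarith [hx.2]))
          (hB x ⟨hx.1.le, hx.2⟩) (norm_nonneg _) zero_le_one
      _ = B := one_mul B
  have i2 : B * |b - a| ≤ B := by
    rw [abs_of_nonneg (by linarith)]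
    exact mul_le_of_le_one_right hB0 hab1
  have i3 := hB b ⟨hab, le_rfl⟩
  have i4 : 0 ≤ N * (b - a) ^ (s - 1 / 2) := by
    have : 0 ≤ b - a := by linarith
    positivity
  simp only [sub_self, Real.exp_zero, Complex.ofReal_one, one_mul, mul_zero, sub_zero]
  calc _ ≤ ‖f b - f a‖ + ‖∫ x in a..b, (Real.exp (x - b) : ℂ) * (f x - f a)‖ := norm_sub_le _ _
    _ ≤ B + B := by linarith
    _ ≤ _ := by rw [hBdef]; nlinarith
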